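/- arXiv:2511.22257 — 3 statements merged into one kernel-verified Lean document; each statement's English description precedes it below -/
import Mathlib

section
/- Let X ⊆ ℂⁿ be open and connected and let u : X → ℂ be smooth and pluriharmonic on X (∂²u/∂z_j∂z̄_k = 0 on X for all 1 ≤ j,k ≤ n). If u vanishes on some nonempty open subset of X, then u vanishes identically on X. -/
open Complex

noncomputable section

/-- Wirtinger derivative `∂u/∂z_j` of `u` within the set `X`, at `z`. -/
def wdz {n : ℕ} (X : Set (Fin n → ℂ)) (u : (Fin n → ℂ) → ℂ) (j : Fin n)
    (z : Fin n → ℂ) : ℂ :=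
  (1 / 2 : ℂ) * (fderivWithin ℝ u X z (Pi.single j 1) -
    Complex.I * fderivWithin ℝ u X z (Pi.single j Complex.I))

/-- Wirtinger derivative `∂u/∂z̄_j` of `u` within the set `X`, at `z`. -/
def wdzbar {n : ℕ} (X : Set (Fin n → ℂ)) (u : (Fin n → ℂ) → ℂ) (j : Fin n)
    (z : Fin n → ℂ) : ℂ :=
  (1 / 2 : ℂ) * (fderivWithin ℝ u X z (Pi.single j 1) +
    Complex.I * fderivWithin ℝ u X z (Pi.single j Complex.I))

/-- `∂²u/∂z_j∂z̄_k` within `X`. -/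
def ddbar {n : ℕ} (X : Set (Fin n → ℂ)) (u : (Fin n → ℂ) → ℂ) (j k : Fin n)
    (z : Fin n → ℂ) : ℂ :=
  wdz X (wdzbar X u k) j z

/-- The support of `u` as a function on `X`: the closure in `X` of its nonvanishing set. -/
def suppIn {n : ℕ} (X : Set (Fin n → ℂ)) (u : (Fin n → ℂ) → ℂ) : Set (Fin n → ℂ) :=
  X ∩ closure {z | z ∈ X ∧ u z ≠ 0}

/-- Support of a (1,1)-form given by its coefficient matrix. -/
def supp11 {n : ℕ} (X : Set (Fin n → ℂ)) (T : Fin n → Fin n → (Fin n → ℂ) → ℂ) :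
    Set (Fin n → ℂ) :=
  ⋃ j, ⋃ k, suppIn X (T j k)

/-- Support of a 1-form `Σ a_j dz_j + Σ b_k dz̄_k`. -/
def supp1 {n : ℕ} (X : Set (Fin n → ℂ)) (a b : Fin n → (Fin n → ℂ) → ℂ) :
    Set (Fin n → ℂ) :=
  (⋃ j, suppIn X (a j)) ∪ (⋃ k, suppIn X (b k))

/-- Smoothness of the coefficients of a (1,1)-form on `X`. -/
def Smooth11 {n : ℕ} (X : Set (Fin n → ℂ)) (f : Fin n → Fin n → (Fin n → ℂ) → ℂ) : Prop :=
  ∀ j k, ContDiffOn ℝ (⊤ : ℕ∞) (f j k) X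

/-- A (1,1)-form `Σ f_{jk} dz_j ∧ dz̄_k` is d-closed. -/
def DClosed11 {n : ℕ} (X : Set (Fin n → ℂ)) (f : Fin n → Fin n → (Fin n → ℂ) → ℂ) : Prop :=
  ∀ j k l, ∀ z ∈ X,
    wdz X (f j k) l z = wdz X (f l k) j z ∧ wdzbar X (f j k) l z = wdzbar X (f j l) k z

/-- `d(Σ a_j dz_j + Σ b_k dz̄_k) = f` for a (1,1)-form `f`. -/
def IsDOf {n : ℕ} (X : Set (Fin n → ℂ)) (a b : Fin n → (Fin n → ℂ) → ℂ)
    (f : Fin n → Fin n → (Fin n → ℂ) → ℂ) : Prop :=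
  (∀ j k, ∀ z ∈ X, f j k z = wdz X (b k) j z - wdzbar X (a j) k z) ∧
  (∀ j l, ∀ z ∈ X, wdz X (a j) l z = wdz X (a l) j z) ∧
  (∀ k l, ∀ z ∈ X, wdzbar X (b k) l z = wdzbar X (b l) k z)

/-- A (0,1)-form `Σ b_k dz̄_k` is ∂̄-closed. -/
def DbarClosed01 {n : ℕ} (X : Set (Fin n → ℂ)) (b : Fin n → (Fin n → ℂ) → ℂ) : Prop :=
  ∀ k l, ∀ z ∈ X, wdzbar X (b k) l z = wdzbar X (b l) k z

/-- A (1,0)-form `Σ a_j dz_j` is ∂-closed. -/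
def DClosed10 {n : ℕ} (X : Set (Fin n → ℂ)) (a : Fin n → (Fin n → ℂ) → ℂ) : Prop :=
  ∀ j l, ∀ z ∈ X, wdz X (a j) l z = wdz X (a l) j z

/-- Identity principle for complex differentiable functions on a complex normed space. -/
theorem eqOn_zero_of_differentiableOn_of_eventuallyEq_zero
    {E : Type*} [NormedAddCommGroup E] [NormedSpace ℂ E] {X : Set E} (hX : IsOpen X)
    (hXc : IsPreconnected X) {f : E → ℂ} (hf : DifferentiableOn ℂ f X) {a : E} (ha : a ∈ X)
    (hfa : f =ᶠ[nhds a] 0) : ∀ z ∈ X, f z = 0 := by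
  have hsub : X ⊆ {z | f =ᶠ[nhds z] 0} := by
    refine hXc.subset_of_closure_inter_subset isOpen_setOfPred_eventually_nhds ⟨a, ha, hfa⟩ ?_
    rintro z ⟨hzc, hzX⟩
    obtain ⟨r, hr, hball⟩ := Metric.isOpen_iff.1 hX z hzX
    obtain ⟨b, hb, hbz⟩ := Metric.mem_closure_iff.1 hzc r hr
    have hbB : b ∈ Metric.ball z r := by rwa [Metric.mem_ball, dist_comm]
    refine Filter.eventually_of_mem (Metric.ball_mem_nhds z hr) fun w hw => ?_
    set l : ℂ → E := fun t => b + t • (w - b) with hl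
    have hld : Differentiable ℂ l := by fun_prop
    have hl0 : l 0 = b := by simp [hl]
    have hl1 : l 1 = w := by simp [hl]
    set S : Set ℂ := l ⁻¹' Metric.ball z r
    have hSo : IsOpen S := Metric.isOpen_ball.preimage hld.continuous
    have hSc : Convex ℝ S := by
      intro s hs t ht p q hp hq hpq
      have hcomb : l (p • s + q • t) = p • l s + q • l t := by
        have hb : b = p • b + q • b := by rw [← add_smul, hpq, one_smul]
        simp only [hl, smul_add, add_smul, smul_assoc]
        nth_rewrite 1 [hb]
        abel
      change l (p • s + q • t) ∈ Metric.ball z r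
      rw [hcomb]
      exact convex_ball z r hs ht hp hq hpq
    have hg : AnalyticOnNhd ℂ (f ∘ l) S :=
      (hf.comp hld.differentiableOn fun t ht => hball ht).analyticOnNhd hSo
    have hg0 : f ∘ l =ᶠ[nhds 0] 0 :=
      (hld.continuous.tendsto' 0 b hl0).eventually hb
    have h0 : (0 : ℂ) ∈ S := by simpa [S, hl0] using hbB
    have h1 : (1 : ℂ) ∈ S := by simpa [S, hl1] using hw
    simpa [hl1] using hg.eqOn_zero_of_preconnected_of_eventuallyEq_zero
      hSc.isPreconnected h0 hg0 h1
  exact fun z hz => (hsub hz).self_of_nhds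

/-- A real differentiable function satisfying the Cauchy-Riemann equations in each coordinate
is complex differentiable. -/
theorem differentiableAt_complex_of_cauchyRiemann {n : ℕ} {f : (Fin n → ℂ) → ℂ} {z : Fin n → ℂ}
    (hf : DifferentiableAt ℝ f z)
    (hCR : ∀ j, fderiv ℝ f z (Pi.single j I) = I * fderiv ℝ f z (Pi.single j 1)) :
    DifferentiableAt ℂ f z := by
  rw [differentiableAt_iff_restrictScalars ℝ hf]
  refine ⟨∑ j, (ContinuousLinearMap.proj (R := ℂ) (φ := fun _ : Fin n => ℂ) j).smulRight
    (fderiv ℝ f z (Pi.single j 1)), ?_⟩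
  ext v
  have hcoord : ∀ j, fderiv ℝ f z (Pi.single j (v j)) =
      v j * fderiv ℝ f z (Pi.single j 1) := by
    intro j
    have hv : (Pi.single j (v j) : Fin n → ℂ) =
        (v j).re • (Pi.single j 1 : Fin n → ℂ) + (v j).im • (Pi.single j I : Fin n → ℂ) := by
      rw [← Pi.single_smul, ← Pi.single_smul, ← Pi.single_add]
      congr 1
      apply Complex.ext <;> simp
    rw [hv, map_add, map_smul, map_smul, hCR, real_smul, real_smul]
    conv_rhs => rw [← re_add_im (v j)]
    ring
  conv_rhs => rw [← Finset.univ_sum_single v, map_sum]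
  simp [hcoord]

theorem differentiableAt_of_wdzbar_eq_zero {n : ℕ} {X : Set (Fin n → ℂ)} (hX : IsOpen X)
    {f : (Fin n → ℂ) → ℂ} (hf : DifferentiableOn ℝ f X) {z : Fin n → ℂ} (hz : z ∈ X)
    (h : ∀ k, wdzbar X f k z = 0) : DifferentiableAt ℂ f z := by
  refine differentiableAt_complex_of_cauchyRiemann (hf.differentiableAt (hX.mem_nhds hz)) ?_
  intro k
  have hk := h k
  rw [wdzbar, fderivWithin_of_isOpen hX hz] at hk
  linear_combination (-2 * I) * hk + fderiv ℝ f z (Pi.single k I) * I_sq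

theorem differentiableAt_conj_of_wdz_eq_zero {n : ℕ} {X : Set (Fin n → ℂ)} (hX : IsOpen X)
    {f : (Fin n → ℂ) → ℂ} (hf : DifferentiableOn ℝ f X) {z : Fin n → ℂ} (hz : z ∈ X)
    (h : ∀ j, wdz X f j z = 0) :
    DifferentiableAt ℂ (fun w => conjCLE (f w)) z := by
  have hfz := hf.differentiableAt (hX.mem_nhds hz)
  refine differentiableAt_complex_of_cauchyRiemann
    (conjCLE.differentiableAt.comp z hfz) ?_
  intro j
  have hj := h j
  rw [wdz, fderivWithin_of_isOpen hX hz] at hj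
  have hD : fderiv ℝ f z (Pi.single j I) = -I * fderiv ℝ f z (Pi.single j 1) := by
    linear_combination (2 * I) * hj + fderiv ℝ f z (Pi.single j I) * I_sq
  have hc : fderiv ℝ (fun w => conjCLE (f w)) z =
      (conjCLE : ℂ →L[ℝ] ℂ).comp (fderiv ℝ f z) :=
    conjCLE.comp_fderiv
  rw [hc]
  simp [hD]

theorem differentiableOn_wdzbar {n : ℕ} {X : Set (Fin n → ℂ)} (hX : IsOpen X)
    {u : (Fin n → ℂ) → ℂ} (hu : ContDiffOn ℝ (⊤ : ℕ∞) u X) (k : Fin n) :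
    DifferentiableOn ℝ (wdzbar X u k) X := by
  have hd : DifferentiableOn ℝ (fderivWithin ℝ u X) X :=
    (hu.fderivWithin hX.uniqueDiffOn (m := 1) (by norm_cast)).differentiableOn
      one_ne_zero
  unfold wdzbar
  fun_prop

/-- Identity principle: a smooth pluriharmonic function on a connected
open set `X ⊆ ℂⁿ` vanishing on a nonempty open subset of `X` vanishes identically on `X`. -/
theorem stmt4 {n : ℕ} (hn : 0 < n) (X : Set (Fin n → ℂ)) (hX : IsOpen X)
    (hXconn : IsConnected X)
    (u : (Fin n → ℂ) → ℂ) (hu : ContDiffOn ℝ (⊤ : ℕ∞) u X)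
    (hph : ∀ j k, ∀ z ∈ X, ddbar X u j k z = 0)
    (V : Set (Fin n → ℂ)) (hV : IsOpen V) (hVne : V.Nonempty) (hVX : V ⊆ X)
    (hvanish : ∀ z ∈ V, u z = 0) :
    ∀ z ∈ X, u z = 0 := by
  obtain ⟨a, ha⟩ := hVne
  have hua : u =ᶠ[nhds a] 0 := Filter.eventually_of_mem (hV.mem_nhds ha) hvanish
  have hbar : ∀ k, ∀ z ∈ X, wdzbar X u k z = 0 := by
    intro k z hz
    have hconj := eqOn_zero_of_differentiableOn_of_eventuallyEq_zero hX hXconn.isPreconnected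
      (f := fun w => conjCLE (wdzbar X u k w))
      (fun w hw => (differentiableAt_conj_of_wdz_eq_zero hX (differentiableOn_wdzbar hX hu k) hw
        fun j => hph j k w hw).differentiableWithinAt) (hVX ha) (by
        filter_upwards [hV.mem_nhds ha] with w hw
        have hw0 : fderiv ℝ u w = 0 := by
          have huw : u =ᶠ[nhds w] fun _ => 0 :=
            Filter.eventually_of_mem (hV.mem_nhds hw) hvanish
          rw [huw.fderiv_eq, fderiv_fun_const]
          rfl
        simp [wdzbar, fderivWithin_of_isOpen hX (hVX hw), hw0]) z hz
    simpa using hconj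
  exact eqOn_zero_of_differentiableOn_of_eventuallyEq_zero hX hXconn.isPreconnected
    (fun w hw => (differentiableAt_of_wdzbar_eq_zero hX
      (hu.differentiableOn (by simp)) hw fun k => hbar k w hw).differentiableWithinAt)
    (hVX ha) hua
end
end

section
/- Let X ⊆ ℂⁿ be open and let Ω ⊆ X be open with closure cl Ω (taken in X) properly contained in X; set Ω^c = X \ cl Ω. Assume: (i) every d-closed smooth (1,1)-form on X with support contained in cl Ω equals dh for some smooth 1-form h on X with support contained in cl Ω; (ii) every ∂̄-closed smooth (0,1)-form on X with support contained in cl Ω equals ∂̄w for some smooth function w on X with support contained in cl Ω; (iii) every ∂-closed smooth (1,0)-form on X with support contained in cl Ω equals ∂w for some smooth function w on X with support contained in cl Ω. Then every function that is pluriharmonic on Ω^c and is the restriction to Ω^c of a smooth function on X coincides on Ω^c with a pluriharmonic function defined on all of X. -/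
open Complex

noncomputable section

/-- The first-order operator `½(∂/∂x_j + c ∂/∂y_j)` within `X`, which specializes to both
Wirtinger derivatives. -/
def wirtinger {n : ℕ} (c : ℂ) (X : Set (Fin n → ℂ)) (u : (Fin n → ℂ) → ℂ) (j : Fin n)
    (z : Fin n → ℂ) : ℂ :=
  (1 / 2 : ℂ) * (fderivWithin ℝ u X z (Pi.single j 1) +
    c * fderivWithin ℝ u X z (Pi.single j Complex.I))

lemma wdz_eq_wirtinger {n : ℕ} : @wdz n = wirtinger (-Complex.I) := by
  funext X u j z
  simp only [wdz, wirtinger]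
  ring

lemma wdzbar_eq_wirtinger {n : ℕ} : @wdzbar n = wirtinger Complex.I := rfl

section wirtinger

variable {n : ℕ} {X : Set (Fin n → ℂ)} {u v : (Fin n → ℂ) → ℂ} {z : Fin n → ℂ}

lemma contDiffOn_fderivWithin_dir (hX : IsOpen X) (hu : ContDiffOn ℝ (⊤ : ℕ∞) u X)
    (e : Fin n → ℂ) : ContDiffOn ℝ (⊤ : ℕ∞) (fun y => fderivWithin ℝ u X y e) X :=
  (hu.fderivWithin hX.uniqueDiffOn (by simp)).clm_apply contDiffOn_const

lemma ContDiffOn.wirtinger (hX : IsOpen X) (hu : ContDiffOn ℝ (⊤ : ℕ∞) u X) (c : ℂ)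
    (j : Fin n) : ContDiffOn ℝ (⊤ : ℕ∞) (wirtinger c X u j) X :=
  contDiffOn_const.mul ((contDiffOn_fderivWithin_dir hX hu _).add
    (contDiffOn_const.mul (contDiffOn_fderivWithin_dir hX hu _)))

lemma fderivWithin_dir_comm (hX : IsOpen X) (hu : ContDiffOn ℝ (⊤ : ℕ∞) u X) (hz : z ∈ X)
    (e e' : Fin n → ℂ) :
    fderivWithin ℝ (fun y => fderivWithin ℝ u X y e) X z e' =
      fderivWithin ℝ (fun y => fderivWithin ℝ u X y e') X z e := by
  have hd : DifferentiableWithinAt ℝ (fderivWithin ℝ u X) X z :=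
    ((hu.fderivWithin (m := (⊤ : ℕ∞)) hX.uniqueDiffOn (by simp)).differentiableOn
      (by simp)) z hz
  have hs : IsSymmSndFDerivWithinAt ℝ u X z :=
    (hu z hz).isSymmSndFDerivWithinAt
      (by simpa using WithTop.coe_le_coe.2 (le_top : (2 : ℕ∞) ≤ ⊤)) hX.uniqueDiffOn
      (subset_closure (hX.interior_eq.symm ▸ hz)) hz
  have key : ∀ e e' : Fin n → ℂ, fderivWithin ℝ (fun y => fderivWithin ℝ u X y e) X z e' =
      fderivWithin ℝ (fderivWithin ℝ u X) X z e' e := fun e e' => by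
    rw [fderivWithin_clm_apply (hX.uniqueDiffWithinAt hz) hd (differentiableWithinAt_const e)]
    simp
  rw [key, key, hs]

lemma fderivWithin_wirtinger (hX : IsOpen X) (hu : ContDiffOn ℝ (⊤ : ℕ∞) u X) (hz : z ∈ X)
    (c : ℂ) (j : Fin n) (e : Fin n → ℂ) :
    fderivWithin ℝ (wirtinger c X u j) X z e =
      (1 / 2 : ℂ) * (fderivWithin ℝ (fun y => fderivWithin ℝ u X y (Pi.single j 1)) X z e +
        c * fderivWithin ℝ (fun y => fderivWithin ℝ u X y (Pi.single j Complex.I)) X z e) := by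
  have hd : ∀ e, DifferentiableWithinAt ℝ (fun y => fderivWithin ℝ u X y e) X z := fun e =>
    (contDiffOn_fderivWithin_dir hX hu e).differentiableOn (by simp) z hz
  have hU := hX.uniqueDiffWithinAt (𝕜 := ℝ) hz
  unfold wirtinger
  rw [fderivWithin_const_mul hU ((hd _).fun_add ((hd _).const_mul c)),
    fderivWithin_fun_add hU (hd _) ((hd _).const_mul c), fderivWithin_const_mul hU (hd _)]
  simp [mul_add]

lemma wirtinger_comm (hX : IsOpen X) (hu : ContDiffOn ℝ (⊤ : ℕ∞) u X) (hz : z ∈ X)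
    (c d : ℂ) (j k : Fin n) :
    wirtinger c X (wirtinger d X u k) j z = wirtinger d X (wirtinger c X u j) k z := by
  rw [wirtinger, fderivWithin_wirtinger hX hu hz, fderivWithin_wirtinger hX hu hz,
    wirtinger, fderivWithin_wirtinger hX hu hz, fderivWithin_wirtinger hX hu hz]
  simp only [fderivWithin_dir_comm hX hu hz (Pi.single k _)]
  ring

lemma wirtinger_congr (h : Set.EqOn u v X) (hz : z ∈ X) (c : ℂ) (j : Fin n) :
    wirtinger c X u j z = wirtinger c X v j z := by
  simp only [wirtinger, fderivWithin_congr h (h hz)]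

lemma wirtinger_sub (hX : IsOpen X) (hu : ContDiffOn ℝ (⊤ : ℕ∞) u X)
    (hv : ContDiffOn ℝ (⊤ : ℕ∞) v X) (hz : z ∈ X) (c : ℂ) (j : Fin n) :
    wirtinger c X (u - v) j z = wirtinger c X u j z - wirtinger c X v j z := by
  simp only [wirtinger, fderivWithin_sub (hX.uniqueDiffWithinAt hz)
    (hu.differentiableOn (by simp) z hz) (hv.differentiableOn (by simp) z hz),
    sub_apply]
  ring

lemma ddbar_sub (hX : IsOpen X) (hu : ContDiffOn ℝ (⊤ : ℕ∞) u X)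
    (hv : ContDiffOn ℝ (⊤ : ℕ∞) v X) (hz : z ∈ X) (j k : Fin n) :
    ddbar X (u - v) j k z = ddbar X u j k z - ddbar X v j k z := by
  simp only [ddbar, wdz_eq_wirtinger, wdzbar_eq_wirtinger]
  rw [← wirtinger_sub hX (hu.wirtinger hX _ _) (hv.wirtinger hX _ _) hz]
  exact wirtinger_congr (fun y hy => wirtinger_sub hX hu hv hy _ _) hz _ _

lemma ddbar_comm (hX : IsOpen X) (hu : ContDiffOn ℝ (⊤ : ℕ∞) u X) (hz : z ∈ X)
    (j k : Fin n) : ddbar X u j k z = wdzbar X (wdz X u j) k z := by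
  simp only [ddbar, wdz_eq_wirtinger, wdzbar_eq_wirtinger]
  exact wirtinger_comm hX hu hz _ _ _ _

lemma smooth11_ddbar (hX : IsOpen X) (hu : ContDiffOn ℝ (⊤ : ℕ∞) u X) :
    Smooth11 X (ddbar X u) := fun j k => by
  unfold ddbar
  simp only [wdz_eq_wirtinger, wdzbar_eq_wirtinger]
  exact (hu.wirtinger hX _ _).wirtinger hX _ _

lemma dClosed11_ddbar (hX : IsOpen X) (hu : ContDiffOn ℝ (⊤ : ℕ∞) u X) :
    DClosed11 X (ddbar X u) := fun j k l z hz => by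
  have hc : ∀ k, Set.EqOn (ddbar X u j k) (wdzbar X (wdz X u j) k) X :=
    fun k y hy => ddbar_comm hX hu hy j k
  simp only [wdz_eq_wirtinger, wdzbar_eq_wirtinger] at hc ⊢
  constructor
  · unfold ddbar
    simp only [wdz_eq_wirtinger, wdzbar_eq_wirtinger]
    exact wirtinger_comm hX (hu.wirtinger hX _ _) hz _ _ _ _
  · rw [wirtinger_congr (hc k) hz, wirtinger_congr (hc l) hz]
    exact wirtinger_comm hX (hu.wirtinger hX _ _) hz _ _ _ _

lemma suppIn_subset_inter_closure {S : Set (Fin n → ℂ)} (h : ∀ z ∈ X \ closure S, u z = 0) :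
    suppIn X u ⊆ X ∩ closure S :=
  Set.inter_subset_inter_right X <| closure_minimal
    (fun z hz => by_contra fun hzS => hz.2 (h z ⟨hz.1, hzS⟩)) isClosed_closure

lemma eq_zero_of_suppIn_subset {S : Set (Fin n → ℂ)} (h : suppIn X u ⊆ X ∩ closure S)
    (hz : z ∈ X \ closure S) : u z = 0 :=
  by_contra fun hne => hz.2 (h ⟨hz.1, subset_closure ⟨hz.1, hne⟩⟩).2

end wirtinger

/-- Extension of pluriharmonic functions: under the vanishing of the
cohomology groups with support in `cl Ω` (hypotheses (i), (ii), (iii)), every pluriharmonic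
function on `Ωᶜ = X \ cl Ω` that is the restriction of a smooth function on `X` coincides
on `Ωᶜ` with a pluriharmonic function on all of `X`. -/
theorem stmt5 {n : ℕ} (hn : 0 < n) (X : Set (Fin n → ℂ)) (hX : IsOpen X)
    (Ω : Set (Fin n → ℂ)) (hΩ : IsOpen Ω) (hΩX : Ω ⊆ X)
    (hProper : (X \ closure Ω).Nonempty)
    (hi : ∀ f : Fin n → Fin n → (Fin n → ℂ) → ℂ, Smooth11 X f → DClosed11 X f →
      supp11 X f ⊆ X ∩ closure Ω →
      ∃ a b : Fin n → (Fin n → ℂ) → ℂ,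
        (∀ j, ContDiffOn ℝ (⊤ : ℕ∞) (a j) X) ∧ (∀ k, ContDiffOn ℝ (⊤ : ℕ∞) (b k) X) ∧
        IsDOf X a b f ∧ supp1 X a b ⊆ X ∩ closure Ω)
    (hii : ∀ b : Fin n → (Fin n → ℂ) → ℂ, (∀ k, ContDiffOn ℝ (⊤ : ℕ∞) (b k) X) →
      DbarClosed01 X b → (⋃ k, suppIn X (b k)) ⊆ X ∩ closure Ω →
      ∃ w : (Fin n → ℂ) → ℂ, ContDiffOn ℝ (⊤ : ℕ∞) w X ∧ suppIn X w ⊆ X ∩ closure Ω ∧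
        ∀ k, ∀ z ∈ X, b k z = wdzbar X w k z)
    (hiii : ∀ a : Fin n → (Fin n → ℂ) → ℂ, (∀ j, ContDiffOn ℝ (⊤ : ℕ∞) (a j) X) →
      DClosed10 X a → (⋃ j, suppIn X (a j)) ⊆ X ∩ closure Ω →
      ∃ w : (Fin n → ℂ) → ℂ, ContDiffOn ℝ (⊤ : ℕ∞) w X ∧ suppIn X w ⊆ X ∩ closure Ω ∧
        ∀ j, ∀ z ∈ X, a j z = wdz X w j z) :
    ∀ Sf : (Fin n → ℂ) → ℂ, ContDiffOn ℝ (⊤ : ℕ∞) Sf X →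
      (∀ j k, ∀ z ∈ X \ closure Ω, ddbar X Sf j k z = 0) →
      ∃ h : (Fin n → ℂ) → ℂ, ContDiffOn ℝ (⊤ : ℕ∞) h X ∧
        (∀ j k, ∀ z ∈ X, ddbar X h j k z = 0) ∧
        Set.EqOn h Sf (X \ closure Ω) := by
  intro Sf hSf hharm
  obtain ⟨a, b, ha, hb, ⟨hf, hda, hdb⟩, hsupp⟩ := hi (ddbar X Sf) (smooth11_ddbar hX hSf)
    (dClosed11_ddbar hX hSf) (Set.iUnion_subset fun j => Set.iUnion_subset fun k =>
      suppIn_subset_inter_closure (hharm j k))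
  obtain ⟨w, hw, hws, hbw⟩ := hii b hb hdb (Set.subset_union_right.trans hsupp)
  obtain ⟨v, hv, hvs, hav⟩ := hiii a ha hda (Set.subset_union_left.trans hsupp)
  have hwv : ContDiffOn ℝ (⊤ : ℕ∞) (w - v) X := hw.sub hv
  refine ⟨Sf - (w - v), hSf.sub hwv, fun j k z hz => ?_, fun z hz => ?_⟩
  · have hbk : wdz X (b k) j z = ddbar X w j k z := by
      rw [ddbar, wdz_eq_wirtinger]
      exact wirtinger_congr (hbw k) hz _ _
    have haj : wdzbar X (a j) k z = ddbar X v j k z := by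
      rw [ddbar_comm hX hv hz]
      exact wirtinger_congr (hav j) hz _ _
    rw [ddbar_sub hX hSf hwv hz, ddbar_sub hX hw hv hz, hf j k z hz, hbk, haj, sub_self]
  · simp [eq_zero_of_suppIn_subset hws hz, eq_zero_of_suppIn_subset hvs hz]
end
end

section
/- Let X ⊆ ℂⁿ be open and nonempty, and let Ω ⊆ X be a nonempty open relatively compact subset whose closure cl Ω is contained in X, such that Ω^c = X \ cl Ω is connected and nonempty. Assume: (i) every d-closed smooth (1,1)-form on X with compact support equals dh for some smooth 1-form h on X with compact support; (ii) every ∂̄-closed smooth (0,1)-form on X with compact support equals ∂̄g for some smooth function g on X with compact support; (iii) every ∂-closed smooth (1,0)-form on X with compact support equals ∂g for some smooth function g on X with compact support. Then for every d-closed smooth (1,1)-form T on X with supp T ⊆ cl Ω, there exists a smooth function S on X with supp S ⊆ cl Ω such that ∂∂̄S = T, i.e. ∂²S/∂z_j∂z̄_k = T_{jk} for all j,k. -/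
open Complex

noncomputable section

/-- The identity principle for functions that are complex differentiable on a preconnected open
subset of a complex normed space. -/
theorem DifferentiableOn.eqOn_zero_of_isPreconnected_of_eventuallyEq_zero
    {E : Type*} [NormedAddCommGroup E] [NormedSpace ℂ E] {f : E → ℂ} {U : Set E}
    (hf : DifferentiableOn ℂ f U) (hUo : IsOpen U) (hU : IsPreconnected U) {z₀ : E}
    (hz₀ : z₀ ∈ U) (hfz₀ : f =ᶠ[nhds z₀] 0) : Set.EqOn f 0 U := by
  let u : Set E := {x | f =ᶠ[nhds x] 0}
  suffices main : closure u ∩ U ⊆ u by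
    have Uu : U ⊆ u :=
      hU.subset_of_closure_inter_subset isOpen_setOfPred_eventually_nhds ⟨z₀, hz₀, hfz₀⟩ main
    intro z hz
    exact (Uu hz).self_of_nhds
  rintro z ⟨hzu, hzU⟩
  obtain ⟨r, hr, hball⟩ := Metric.isOpen_iff.1 hUo z hzU
  obtain ⟨y, hyu, hyz⟩ := Metric.mem_closure_iff.1 hzu r hr
  have hyB : y ∈ Metric.ball z r := by rwa [Metric.mem_ball, dist_comm]
  filter_upwards [Metric.ball_mem_nhds z hr] with v hv
  let φ : ℂ → E := fun t => y + t • (v - y)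
  have hφ : Differentiable ℂ φ := by fun_prop
  let W : Set ℂ := φ ⁻¹' Metric.ball z r
  have hWo : IsOpen W := Metric.isOpen_ball.preimage hφ.continuous
  have hWc : Convex ℝ W := by
    let _ : NormedSpace ℝ E := NormedSpace.restrictScalars ℝ ℂ E
    have h1 : Convex ℝ ((fun x => y + x) ⁻¹' Metric.ball z r) :=
      (convex_ball z r).translate_preimage_right y
    exact h1.is_linear_preimage (f := fun t : ℂ => t • (v - y))
      ⟨fun a b => add_smul a b _, fun c a => smul_assoc c a _⟩
  have hg : AnalyticOnNhd ℂ (f ∘ φ) W :=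
    ((hf.mono hball).comp hφ.differentiableOn fun _ h => h).analyticOnNhd hWo
  have h0 : (0 : ℂ) ∈ W := by simpa [W, φ] using hyB
  have h1 : (1 : ℂ) ∈ W := by simpa [W, φ] using hv
  have hev : f ∘ φ =ᶠ[nhds 0] 0 := by
    have : Filter.Tendsto φ (nhds 0) (nhds y) := by
      simpa [φ] using hφ.continuous.tendsto 0
    exact this.eventually hyu
  simpa [φ] using hg.eqOn_zero_of_preconnected_of_eventuallyEq_zero hWc.isPreconnected h0 hev h1

section Wirtinger

variable {n : ℕ} {X U : Set (Fin n → ℂ)} {u v : (Fin n → ℂ) → ℂ} {z : Fin n → ℂ}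

theorem wdz_congr (h : Set.EqOn u v X) (hz : z ∈ X) (j : Fin n) :
    wdz X u j z = wdz X v j z := by
  simp only [wdz, fderivWithin_congr h (h hz)]

theorem wdzbar_congr (h : Set.EqOn u v X) (hz : z ∈ X) (j : Fin n) :
    wdzbar X u j z = wdzbar X v j z := by
  simp only [wdzbar, fderivWithin_congr h (h hz)]

theorem wdz_sub (hX : IsOpen X) (hu : DifferentiableOn ℝ u X) (hv : DifferentiableOn ℝ v X)
    (hz : z ∈ X) (j : Fin n) :
    wdz X (fun w => u w - v w) j z = wdz X u j z - wdz X v j z := by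
  simp only [wdz, fderivWithin_fun_sub (hX.uniqueDiffWithinAt hz) (hu z hz) (hv z hz),
    sub_apply]
  ring

theorem wdzbar_sub (hX : IsOpen X) (hu : DifferentiableOn ℝ u X) (hv : DifferentiableOn ℝ v X)
    (hz : z ∈ X) (j : Fin n) :
    wdzbar X (fun w => u w - v w) j z = wdzbar X u j z - wdzbar X v j z := by
  simp only [wdzbar, fderivWithin_fun_sub (hX.uniqueDiffWithinAt hz) (hu z hz) (hv z hz),
    sub_apply]
  ring

theorem contDiffOn_wdzbar (hX : IsOpen X) (hu : ContDiffOn ℝ (⊤ : ℕ∞) u X) (k : Fin n) :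
    ContDiffOn ℝ (⊤ : ℕ∞) (wdzbar X u k) X := by
  have h : ContDiffOn ℝ (⊤ : ℕ∞) (fderivWithin ℝ u X) X :=
    hu.fderivWithin hX.uniqueDiffOn (by simp)
  unfold wdzbar
  fun_prop

theorem wdz_wdzbar_comm (hX : IsOpen X) (hu : ContDiffOn ℝ (⊤ : ℕ∞) u X) (hz : z ∈ X)
    (j k : Fin n) : wdz X (wdzbar X u k) j z = wdzbar X (wdz X u j) k z := by
  have hD : DifferentiableWithinAt ℝ (fderivWithin ℝ u X) X z :=
    ((hu.fderivWithin (m := 1) hX.uniqueDiffOn (by norm_cast)).differentiableOn one_ne_zero) z hz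
  have hzX : UniqueDiffWithinAt ℝ X z := hX.uniqueDiffWithinAt hz
  have hsymm : IsSymmSndFDerivWithinAt ℝ u X z :=
    (hu z hz).isSymmSndFDerivWithinAt
      (by rw [minSmoothness_of_isRCLikeNormedField]; exact WithTop.coe_le_coe.2 le_top)
      hX.uniqueDiffOn
      (by rw [hX.interior_eq]; exact subset_closure hz) hz
  have happ (e : Fin n → ℂ) : HasFDerivWithinAt (fun w => fderivWithin ℝ u X w e)
      ((fderivWithin ℝ (fderivWithin ℝ u X) X z).flip e) X z := by
    simpa using hD.hasFDerivWithinAt.clm_apply (hasFDerivWithinAt_const e z X)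
  have hbar := (((happ (Pi.single k 1)).add
    ((happ (Pi.single k I)).const_mul I)).const_mul (1 / 2 : ℂ)).fderivWithin hzX
  have hdz := (((happ (Pi.single j 1)).sub
    ((happ (Pi.single j I)).const_mul I)).const_mul (1 / 2 : ℂ)).fderivWithin hzX
  have hbar' : fderivWithin ℝ (wdzbar X u k) X z = _ := hbar
  have hdz' : fderivWithin ℝ (wdz X u j) X z = _ := hdz
  rw [wdz, wdzbar, hbar', hdz']
  simp only [smul_apply, add_apply,
    sub_apply, ContinuousLinearMap.flip_apply, smul_eq_mul]
  rw [hsymm (Pi.single j 1) (Pi.single k 1), hsymm (Pi.single j 1) (Pi.single k I),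
    hsymm (Pi.single j I) (Pi.single k 1), hsymm (Pi.single j I) (Pi.single k I)]
  ring

/-- The Cauchy–Riemann equations in all variables give complex differentiability. -/
theorem differentiableAt_complex_of_wdzbar_eq_zero (hX : IsOpen X)
    (hu : DifferentiableOn ℝ u X) (hz : z ∈ X) (h : ∀ k, wdzbar X u k z = 0) :
    DifferentiableAt ℂ u z := by
  have hd : DifferentiableAt ℝ u z := hu.differentiableAt (hX.mem_nhds hz)
  rw [differentiableAt_iff_restrictScalars ℝ hd]
  have hCR (k : Fin n) :
      fderiv ℝ u z (Pi.single k I) = I * fderiv ℝ u z (Pi.single k 1) := by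
    have hk := h k
    rw [wdzbar, fderivWithin_of_isOpen hX hz] at hk
    linear_combination (-2 * I) * hk + fderiv ℝ u z (Pi.single k I) * I_sq
  refine ⟨∑ k, (ContinuousLinearMap.proj (R := ℂ) (φ := fun _ : Fin n => ℂ) k).smulRight
    (fderiv ℝ u z (Pi.single k 1)), ?_⟩
  ext w
  have hw : fderiv ℝ u z w = ∑ k, fderiv ℝ u z (Pi.single k (w k)) := by
    rw [← map_sum, Finset.univ_sum_single]
  rw [hw]
  simp only [ContinuousLinearMap.coe_restrictScalars', sum_apply,
    ContinuousLinearMap.smulRight_apply, ContinuousLinearMap.proj_apply, smul_eq_mul]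
  refine Finset.sum_congr rfl fun k _ => ?_
  have hs : (Pi.single k (w k) : Fin n → ℂ) =
      (w k).re • (Pi.single k 1 : Fin n → ℂ) + (w k).im • (Pi.single k I : Fin n → ℂ) := by
    rw [← Pi.single_smul, ← Pi.single_smul, ← Pi.single_add]
    congr 1
    simp [re_add_im]
  rw [hs, map_add, map_smul, map_smul, hCR, real_smul, real_smul]
  conv_lhs => rw [← re_add_im (w k)]
  ring

theorem wdzbar_conj (hX : IsOpen X) (hz : z ∈ X) (k : Fin n) :
    wdzbar X (fun w => (starRingEnd ℂ) (u w)) k z = (starRingEnd ℂ) (wdz X u k z) := by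
  have h : fderivWithin ℝ (fun w => (starRingEnd ℂ) (u w)) X z =
      (conjCLE : ℂ →L[ℝ] ℂ).comp (fderivWithin ℝ u X z) :=
    conjCLE.comp_fderivWithin (hX.uniqueDiffWithinAt hz)
  simp only [wdz, wdzbar, h, map_mul, map_sub, conj_I, map_div₀, map_one, map_ofNat,
    ContinuousLinearMap.comp_apply, ContinuousLinearEquiv.coe_coe, conjCLE_apply]
  ring

theorem eqOn_zero_of_wdzbar_eq_zero (hX : IsOpen X) (hu : DifferentiableOn ℝ u X)
    (hU : IsOpen U) (hUX : U ⊆ X) (hUc : IsPreconnected U)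
    (h : ∀ k, ∀ w ∈ U, wdzbar X u k w = 0) (hz : z ∈ U) (huz : u =ᶠ[nhds z] 0) :
    Set.EqOn u 0 U :=
  DifferentiableOn.eqOn_zero_of_isPreconnected_of_eventuallyEq_zero
    (fun w hw => (differentiableAt_complex_of_wdzbar_eq_zero hX hu (hUX hw)
      fun k => h k w hw).differentiableWithinAt) hU hUc hz huz

theorem eqOn_zero_of_wdz_eq_zero (hX : IsOpen X) (hu : DifferentiableOn ℝ u X)
    (hU : IsOpen U) (hUX : U ⊆ X) (hUc : IsPreconnected U)
    (h : ∀ k, ∀ w ∈ U, wdz X u k w = 0) (hz : z ∈ U) (huz : u =ᶠ[nhds z] 0) :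
    Set.EqOn u 0 U := by
  have hu' : DifferentiableOn ℝ (fun w => (starRingEnd ℂ) (u w)) X :=
    conjCLE.differentiable.comp_differentiableOn hu
  have := eqOn_zero_of_wdzbar_eq_zero hX hu' hU hUX hUc
    (fun k w hw => by rw [wdzbar_conj hX (hUX hw), h k w hw, map_zero]) hz
    (huz.mono fun w hw => by simp [hw])
  intro w hw
  simpa using this hw

/-- Unique continuation for pluriharmonic functions. -/
theorem eqOn_zero_of_ddbar_eq_zero (hX : IsOpen X) (hu : ContDiffOn ℝ (⊤ : ℕ∞) u X)
    (hU : IsOpen U) (hUX : U ⊆ X) (hUc : IsPreconnected U)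
    (h : ∀ j k, ∀ w ∈ U, ddbar X u j k w = 0) (hz : z ∈ U) (huz : u =ᶠ[nhds z] 0) :
    Set.EqOn u 0 U := by
  have hdiff : DifferentiableOn ℝ u X := hu.differentiableOn (by simp)
  refine eqOn_zero_of_wdzbar_eq_zero hX hdiff hU hUX hUc (fun k w hw => ?_) hz huz
  refine eqOn_zero_of_wdz_eq_zero hX ((contDiffOn_wdzbar hX hu k).differentiableOn (by simp))
    hU hUX hUc (fun j w hw => h j k w hw) hz ?_ hw
  filter_upwards [huz.eventually_nhds, hX.mem_nhds (hUX hz)] with w hw hwX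
  rw [wdzbar, fderivWithin_of_isOpen hX hwX, Filter.EventuallyEq.fderiv_eq hw]
  simp

theorem eq_zero_of_notMem_suppIn (hz : z ∈ X) (h : z ∉ suppIn X u) : u z = 0 := by
  by_contra hne
  exact h ⟨hz, subset_closure ⟨hz, hne⟩⟩

theorem isCompact_iUnion_suppIn_of_subset {ι : Type*} [Finite ι] {K : Set (Fin n → ℂ)}
    {f : ι → (Fin n → ℂ) → ℂ} (hK : IsCompact K) (hKX : K ⊆ X)
    (h : ∀ i, suppIn X (f i) ⊆ K) : IsCompact (⋃ i, suppIn X (f i)) := by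
  refine isCompact_iUnion fun i => ?_
  have : suppIn X (f i) = K ∩ closure {z | z ∈ X ∧ f i z ≠ 0} :=
    Set.Subset.antisymm (fun z hz => ⟨h i hz, hz.2⟩) fun z hz => ⟨hKX hz.1, hz.2⟩
  rw [this]
  exact hK.inter_right isClosed_closure

end Wirtinger

/-- Let `Ω` be a nonempty open relatively compact subset of the nonempty
open set `X ⊆ ℂⁿ` with `cl Ω ⊆ X` and `Ωᶜ = X \ cl Ω` connected and nonempty. Under the
compactly supported cohomological hypotheses (i), (ii), (iii), every d-closed smooth
(1,1)-form `T` on `X` with `supp T ⊆ cl Ω` is `∂∂̄S` for some smooth `S` with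
`supp S ⊆ cl Ω`. -/
theorem stmt10 {n : ℕ} (hn : 0 < n) (X : Set (Fin n → ℂ)) (hX : IsOpen X)
    (hXne : X.Nonempty)
    (Ω : Set (Fin n → ℂ)) (hΩ : IsOpen Ω) (hΩne : Ω.Nonempty)
    (hΩcpt : IsCompact (closure Ω)) (hΩX : closure Ω ⊆ X)
    (hΩcconn : IsConnected (X \ closure Ω))
    (hi : ∀ f : Fin n → Fin n → (Fin n → ℂ) → ℂ, Smooth11 X f → DClosed11 X f →
      IsCompact (supp11 X f) →
      ∃ a b : Fin n → (Fin n → ℂ) → ℂ,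
        (∀ j, ContDiffOn ℝ (⊤ : ℕ∞) (a j) X) ∧ (∀ k, ContDiffOn ℝ (⊤ : ℕ∞) (b k) X) ∧
        IsDOf X a b f ∧ IsCompact (supp1 X a b))
    (hii : ∀ b : Fin n → (Fin n → ℂ) → ℂ, (∀ k, ContDiffOn ℝ (⊤ : ℕ∞) (b k) X) →
      DbarClosed01 X b → IsCompact (⋃ k, suppIn X (b k)) →
      ∃ g : (Fin n → ℂ) → ℂ, ContDiffOn ℝ (⊤ : ℕ∞) g X ∧ IsCompact (suppIn X g) ∧
        ∀ k, ∀ z ∈ X, b k z = wdzbar X g k z)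
    (hiii : ∀ a : Fin n → (Fin n → ℂ) → ℂ, (∀ j, ContDiffOn ℝ (⊤ : ℕ∞) (a j) X) →
      DClosed10 X a → IsCompact (⋃ j, suppIn X (a j)) →
      ∃ g : (Fin n → ℂ) → ℂ, ContDiffOn ℝ (⊤ : ℕ∞) g X ∧ IsCompact (suppIn X g) ∧
        ∀ j, ∀ z ∈ X, a j z = wdz X g j z) :
    ∀ T : Fin n → Fin n → (Fin n → ℂ) → ℂ, Smooth11 X T → DClosed11 X T →
      supp11 X T ⊆ closure Ω →
      ∃ S : (Fin n → ℂ) → ℂ, ContDiffOn ℝ (⊤ : ℕ∞) S X ∧ suppIn X S ⊆ closure Ω ∧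
        ∀ j k, ∀ z ∈ X, T j k z = ddbar X S j k z := by
  intro T hT hTd hTs
  have hTc : IsCompact (supp11 X T) :=
    isCompact_iUnion fun j => isCompact_iUnion_suppIn_of_subset hΩcpt hΩX fun k =>
      (Set.subset_iUnion_of_subset j (Set.subset_iUnion (fun k => suppIn X (T j k)) k)).trans hTs
  obtain ⟨a, b, ha, hb, ⟨hab, had, hbd⟩, habc⟩ := hi T hT hTd hTc
  have hsuppX : supp1 X a b ⊆ X :=
    Set.union_subset (Set.iUnion_subset fun _ => Set.inter_subset_left)
      (Set.iUnion_subset fun _ => Set.inter_subset_left)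
  obtain ⟨g, hg, hgc, hgb⟩ := hii b hb hbd <|
    isCompact_iUnion_suppIn_of_subset habc hsuppX fun k =>
      (Set.subset_iUnion (fun k => suppIn X (b k)) k).trans Set.subset_union_right
  obtain ⟨p, hp, hpc, hpa⟩ := hiii a ha had <|
    isCompact_iUnion_suppIn_of_subset habc hsuppX fun j =>
      (Set.subset_iUnion (fun j => suppIn X (a j)) j).trans Set.subset_union_left
  have hgdiff : DifferentiableOn ℝ g X := hg.differentiableOn (by simp)
  have hpdiff : DifferentiableOn ℝ p X := hp.differentiableOn (by simp)
  have hS : ContDiffOn ℝ (⊤ : ℕ∞) (fun w => g w - p w) X := hg.sub hp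
  have hTS : ∀ j k, ∀ z ∈ X, T j k z = ddbar X (fun w => g w - p w) j k z := by
    intro j k z hz
    rw [hab j k z hz, wdz_congr (fun w hw => hgb k w hw) hz,
      wdzbar_congr (fun w hw => hpa j w hw) hz, ← wdz_wdzbar_comm hX hp hz, ddbar,
      wdz_congr (fun w hw => wdzbar_sub hX hgdiff hpdiff hw k) hz,
      wdz_sub hX ((contDiffOn_wdzbar hX hg k).differentiableOn (by simp))
        ((contDiffOn_wdzbar hX hp k).differentiableOn (by simp)) hz]
  refine ⟨fun w => g w - p w, hS, ?_, hTS⟩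
  have hUo : IsOpen (X \ closure Ω) := hX.sdiff isClosed_closure
  let K : Set (Fin n → ℂ) := closure Ω ∪ (suppIn X g ∪ suppIn X p)
  have hK : IsCompact K := hΩcpt.union (hgc.union hpc)
  have hKX : K ⊆ X :=
    Set.union_subset hΩX (Set.union_subset Set.inter_subset_left Set.inter_subset_left)
  obtain ⟨z₀, hz₀X, hz₀K⟩ : ∃ z ∈ X, z ∉ K := by
    by_contra! hXK
    have hXc : IsCompact X := hKX.antisymm hXK ▸ hK
    have : Nonempty (Fin n) := ⟨⟨0, hn⟩⟩
    have huniv : X = Set.univ := IsClopen.eq_univ ⟨hXc.isClosed, hX⟩ hXne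
    exact noncompact_univ (Fin n → ℂ) (huniv ▸ hXc)
  have hev : (fun w => g w - p w) =ᶠ[nhds z₀] 0 := by
    filter_upwards [(hX.sdiff hK.isClosed).mem_nhds ⟨hz₀X, hz₀K⟩] with w hw
    simp [eq_zero_of_notMem_suppIn hw.1 fun h => hw.2 (Or.inr (Or.inl h)),
      eq_zero_of_notMem_suppIn hw.1 fun h => hw.2 (Or.inr (Or.inr h))]
  have hzero : Set.EqOn (fun w => g w - p w) 0 (X \ closure Ω) := by
    refine eqOn_zero_of_ddbar_eq_zero hX hS hUo Set.sdiff_subset hΩcconn.isPreconnected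
      (fun j k w hw => ?_) ⟨hz₀X, fun h => hz₀K (Or.inl h)⟩ hev
    rw [← hTS j k w hw.1]
    exact eq_zero_of_notMem_suppIn hw.1 fun h =>
      hw.2 (hTs (Set.mem_iUnion.2 ⟨j, Set.mem_iUnion.2 ⟨k, h⟩⟩))
  refine Set.inter_subset_right.trans (closure_minimal ?_ isClosed_closure)
  rintro w ⟨hwX, hw⟩
  by_contra hwΩ
  exact hw (hzero ⟨hwX, hwΩ⟩)
end
end
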